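/- There exists a compact convex body Ω ⊂ ℝ² with C¹ arclength boundary parametrization c of period L whose boundary is not a circle, such that A_{1/2}(s) = A_{1/2}(0) for all s, where A_{1/2}(s) = (1/2)·∫_s^{s+L/2} det(c(t) − c(s), c'(t)) dt. That is, there exists a non-circular convex domain that floats in the archimedean sense in equilibrium in every orientation at density δ = 1/2. -/

import Mathlib

open Real InnerProductGeometry

/-- The plane `ℝ²`. -/
abbrev Plane := EuclideanSpace ℝ (Fin 2)

/-- `c : ℝ → ℝ²` is a `C¹` arclength parametrization, of period `L`, of the
boundary of the plane body `Ω`. -/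
structure IsArclengthParam (Ω : Set Plane) (c : ℝ → Plane) (L : ℝ) : Prop where
  hL : 0 < L
  contDiff : ContDiff ℝ 1 c
  unitSpeed : ∀ s, ‖deriv c s‖ = 1
  periodic : Function.Periodic c L
  injOn : Set.InjOn c (Set.Ico 0 L)
  range_eq : Set.range c = frontier Ω

/-- The determinant `det(u,v) = u₁ v₂ − u₂ v₁` of a pair of plane vectors. -/
noncomputable def det2 (u v : Plane) : ℝ := u 0 * v 1 - u 1 * v 0

/-- The area `A_δ(s)` cut off by the boundary arc from `c s` to `c (s + δL)`
and its chord. -/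
noncomputable def cutArea (c : ℝ → Plane) (L δ s : ℝ) : ℝ :=
  (1 / 2) * ∫ t in s..(s + δ * L), det2 (c t - c s) (deriv c t)

open Set Filter Topology MeasureTheory

namespace Zindler

lemma hasDerivAt_plane {f g : ℝ → ℝ} {f' g' s : ℝ} (hf : HasDerivAt f f' s)
    (hg : HasDerivAt g g' s) :
    HasDerivAt (fun t => (!₂[f t, g t] : Plane)) !₂[f', g'] s := by
  have h : HasDerivAt (fun t => ![f t, g t]) ![f', g'] s := by
    rw [hasDerivAt_pi]
    intro i
    fin_cases i
    · simpa using hf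
    · simpa using hg
  exact (PiLp.continuousLinearEquiv 2 ℝ (fun _ : Fin 2 => ℝ)).symm.toContinuousLinearMap
    |>.hasFDerivAt.comp_hasDerivAt s h

/-- A continuous periodic speed function bounded below by `1` admits an arclength
reparametrization. -/
lemma exists_arclength_reparam {w : ℝ → ℝ} (hw : Continuous w) (hw1 : ∀ t, 1 ≤ w t) {p : ℝ}
    (hp : 0 < p) (hper : Function.Periodic w p) :
    ∃ (Θ : ℝ → ℝ) (h : ℝ), 0 < h ∧ StrictMono Θ ∧ Function.Surjective Θ ∧
      (∀ s, HasDerivAt Θ (w (Θ s))⁻¹ s) ∧ ∀ s, Θ (s + h) = Θ s + p := by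
  set S : ℝ → ℝ := fun t => ∫ u in (0 : ℝ)..t, w u with hS
  have hd : ∀ t, HasDerivAt S (w t) t := fun t => (hw.integral_hasStrictDerivAt 0 t).hasDerivAt
  have hS0 : S 0 = 0 := by simp [hS]
  have hmono : StrictMono S := strictMono_of_deriv_pos fun t => by
    rw [(hd t).deriv]; linarith [hw1 t]
  have hd' : ∀ t, HasDerivAt (fun t => S t - t) (w t - 1) t := fun t =>
    (hd t).sub (hasDerivAt_id t)
  have hmono' : Monotone fun t => S t - t :=
    monotone_of_deriv_nonneg (fun t => (hd' t).differentiableAt) fun t => by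
      rw [(hd' t).deriv]; linarith [hw1 t]
  have hcont : Continuous S := continuous_iff_continuousAt.2 fun t => (hd t).continuousAt
  have hsurj : Function.Surjective S := by
    refine hcont.surjective ?_ ?_
    · refine tendsto_atTop_mono' _ ?_ tendsto_id
      filter_upwards [eventually_ge_atTop 0] with t ht
      have := hmono' ht
      simp only [hS0, id] at this ⊢
      linarith
    · refine tendsto_atBot_mono' _ ?_ tendsto_id
      filter_upwards [eventually_le_atBot 0] with t ht
      have := hmono' ht
      simp only [hS0, id] at this ⊢
      linarith
  have hSp : ∀ t, S (t + p) = S t + S p := by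
    intro t
    have h1 := hper.intervalIntegral_add_eq t 0
    have h2 := intervalIntegral.integral_add_adjacent_intervals
      (hw.intervalIntegrable (μ := volume) 0 t) (hw.intervalIntegrable (μ := volume) t (t + p))
    rw [zero_add] at h1
    simp only [hS]
    rw [← h2, h1]
  let e := StrictMono.orderIsoOfSurjective S hmono hsurj
  have he : ∀ t, S (e.symm t) = t := fun t => e.apply_symm_apply t
  refine ⟨e.symm, S p, ?_, e.symm.strictMono, e.symm.surjective, fun s => ?_, fun s => ?_⟩
  · rw [← hS0]; exact hmono hp
  · exact (hd _).of_local_left_inverse e.symm.continuous.continuousAt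
      (by linarith [hw1 (e.symm s)]) (Eventually.of_forall he)
  · apply hmono.injective
    rw [he, hSp, he]

/-- The area cut off by chords is constant when each chord is parallel to the sum of the
velocities at its endpoints. -/
lemma cutArea_const {x y x' y' : ℝ → ℝ} {L δ : ℝ} (hx : ∀ s, HasDerivAt x (x' s) s)
    (hy : ∀ s, HasDerivAt y (y' s) s) (hx' : Continuous x') (hy' : Continuous y')
    (h : ∀ s, (x (s + δ * L) - x s) * (y' (s + δ * L) + y' s) =
      (y (s + δ * L) - y s) * (x' (s + δ * L) + x' s)) (s t : ℝ) :
    cutArea (fun u => !₂[x u, y u]) L δ s = cutArea (fun u => !₂[x u, y u]) L δ t := by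
  have hxc : Continuous x := continuous_iff_continuousAt.2 fun t => (hx t).continuousAt
  have hyc : Continuous y := continuous_iff_continuousAt.2 fun t => (hy t).continuousAt
  set k := δ * L with hk
  set f : ℝ → ℝ := fun u => x u * y' u - y u * x' u with hf
  have hfc : Continuous f := by fun_prop
  set F : ℝ → ℝ := fun u => ∫ v in (0 : ℝ)..u, f v with hF
  have hFd : ∀ u, HasDerivAt F (f u) u := fun u =>
    (hfc.integral_hasStrictDerivAt 0 u).hasDerivAt
  have key : ∀ s, cutArea (fun u => !₂[x u, y u]) L δ s = (1 / 2) * ((F (s + k) - F s) -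
      (x s * (y (s + k) - y s) - y s * (x (s + k) - x s))) := by
    intro s
    have hd : ∀ u, deriv (fun u => (!₂[x u, y u] : Plane)) u = !₂[x' u, y' u] := fun u =>
      (hasDerivAt_plane (hx u) (hy u)).deriv
    have h1 : ∫ v in s..(s + k), f v = F (s + k) - F s :=
      (intervalIntegral.integral_interval_sub_left (hfc.intervalIntegrable _ _)
        (hfc.intervalIntegrable _ _)).symm
    have h2 : ∫ v in s..(s + k), y' v = y (s + k) - y s :=
      intervalIntegral.integral_eq_sub_of_hasDerivAt (fun u _ => hy u)
        (hy'.intervalIntegrable _ _)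
    have h3 : ∫ v in s..(s + k), x' v = x (s + k) - x s :=
      intervalIntegral.integral_eq_sub_of_hasDerivAt (fun u _ => hx u)
        (hx'.intervalIntegrable _ _)
    unfold cutArea
    rw [← h1, ← h2, ← h3, ← intervalIntegral.integral_const_mul (x s),
      ← intervalIntegral.integral_const_mul (y s), ← intervalIntegral.integral_sub,
      ← intervalIntegral.integral_sub]
    · congr 1
      apply intervalIntegral.integral_congr
      intro v _
      simp [hd, det2, hf]
      ring
    all_goals exact Continuous.intervalIntegrable (by fun_prop) _ _
  have hder : ∀ s, HasDerivAt (fun s => (1 / 2) * ((F (s + k) - F s) -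
      (x s * (y (s + k) - y s) - y s * (x (s + k) - x s)))) 0 s := by
    intro s
    have hFk := (hFd (s + k)).comp_add_const s k
    have hxk := (hx (s + k)).comp_add_const s k
    have hyk := (hy (s + k)).comp_add_const s k
    refine (((hFk.sub (hFd s)).sub (((hx s).mul (hyk.sub (hy s))).sub
      ((hy s).mul (hxk.sub (hx s))))).const_mul (1 / 2)).congr_deriv ?_
    simp only [hf, Pi.sub_apply]
    linear_combination (1 / 2 : ℝ) * h s
  rw [key, key]
  exact is_const_of_deriv_eq_zero (fun u => (hder u).differentiableAt)
    (fun u => (hder u).deriv) s t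

/-- The speed, along the direction of the halving chord at angle `θ`, of the midpoint of
that chord. -/
noncomputable def rho (θ : ℝ) : ℝ := cos (3 * θ) / 5

/-- The derivative of `rho`. -/
noncomputable def rho' (θ : ℝ) : ℝ := -(3 * sin (3 * θ)) / 5

/-- First coordinate of the midpoint of the halving chord at angle `θ`. -/
noncomputable def midX (θ : ℝ) : ℝ := sin (4 * θ) / 40 + sin (2 * θ) / 20

/-- Second coordinate of the midpoint of the halving chord at angle `θ`. -/
noncomputable def midY (θ : ℝ) : ℝ := -cos (4 * θ) / 40 + cos (2 * θ) / 20

/-- First coordinate of the Zindler curve. -/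
noncomputable def curveX (θ : ℝ) : ℝ := midX θ + cos θ

/-- Second coordinate of the Zindler curve. -/
noncomputable def curveY (θ : ℝ) : ℝ := midY θ + sin θ

/-- First coordinate of the outer normal of the Zindler curve. -/
noncomputable def normalX (θ : ℝ) : ℝ := cos θ + rho θ * sin θ

/-- Second coordinate of the outer normal of the Zindler curve. -/
noncomputable def normalY (θ : ℝ) : ℝ := sin θ - rho θ * cos θ

lemma hasDerivAt_rho (θ : ℝ) : HasDerivAt rho (rho' θ) θ := by
  have h := ((((hasDerivAt_id θ).const_mul 3).cos).div_const 5)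
  refine h.congr_deriv ?_
  simp only [rho', id]; ring

lemma rho_add_pi (θ : ℝ) : rho (θ + π) = -rho θ := by
  have : cos (3 * (θ + π)) = -cos (3 * θ) := by
    rw [show 3 * (θ + π) = 3 * θ + π + 2 * π by ring, cos_add_two_pi, cos_add_pi]
  rw [rho, rho, this]; ring

lemma abs_rho_le (θ : ℝ) : |rho θ| ≤ 1 / 5 := by
  rw [rho, abs_div, abs_of_pos (by norm_num : (0 : ℝ) < 5)]
  linarith [abs_cos_le_one (3 * θ)]

lemma rho'_lt_one (θ : ℝ) : rho' θ < 1 := by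
  rw [rho']; linarith [neg_one_le_sin (3 * θ)]

lemma midX_add_pi (θ : ℝ) : midX (θ + π) = midX θ := by
  have h2 : sin (2 * (θ + π)) = sin (2 * θ) := by
    rw [show 2 * (θ + π) = 2 * θ + 2 * π by ring, sin_add_two_pi]
  have h4 : sin (4 * (θ + π)) = sin (4 * θ) := by
    rw [show 4 * (θ + π) = 4 * θ + 2 * π + 2 * π by ring, sin_add_two_pi, sin_add_two_pi]
  rw [midX, midX, h2, h4]

lemma midY_add_pi (θ : ℝ) : midY (θ + π) = midY θ := by
  have h2 : cos (2 * (θ + π)) = cos (2 * θ) := by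
    rw [show 2 * (θ + π) = 2 * θ + 2 * π by ring, cos_add_two_pi]
  have h4 : cos (4 * (θ + π)) = cos (4 * θ) := by
    rw [show 4 * (θ + π) = 4 * θ + 2 * π + 2 * π by ring, cos_add_two_pi, cos_add_two_pi]
  rw [midY, midY, h2, h4]

lemma hasDerivAt_curveX (θ : ℝ) : HasDerivAt curveX (-normalY θ) θ := by
  have h := ((((hasDerivAt_id θ).const_mul 4).sin.div_const 40).add
    (((hasDerivAt_id θ).const_mul 2).sin.div_const 20)).add (hasDerivAt_cos θ)
  refine h.congr_deriv ?_
  have h4 : cos (4 * θ) = cos (3 * θ) * cos θ - sin (3 * θ) * sin θ := by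
    rw [← cos_add]; ring_nf
  have h2 : cos (2 * θ) = cos (3 * θ) * cos θ + sin (3 * θ) * sin θ := by
    rw [← cos_sub]; ring_nf
  simp only [normalY, rho, id, h4, h2]; ring

lemma hasDerivAt_curveY (θ : ℝ) : HasDerivAt curveY (normalX θ) θ := by
  have h := ((((hasDerivAt_id θ).const_mul 4).cos.neg.div_const 40).add
    (((hasDerivAt_id θ).const_mul 2).cos.div_const 20)).add (hasDerivAt_sin θ)
  refine h.congr_deriv ?_
  have h4 : sin (4 * θ) = sin (3 * θ) * cos θ + cos (3 * θ) * sin θ := by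
    rw [← sin_add]; ring_nf
  have h2 : sin (2 * θ) = sin (3 * θ) * cos θ - cos (3 * θ) * sin θ := by
    rw [← sin_sub]; ring_nf
  simp only [normalX, rho, id, h4, h2]; ring

lemma hasDerivAt_normalX (θ : ℝ) :
    HasDerivAt normalX (-sin θ + (rho' θ * sin θ + rho θ * cos θ)) θ :=
  (hasDerivAt_cos θ).add ((hasDerivAt_rho θ).mul (hasDerivAt_sin θ))

lemma hasDerivAt_normalY (θ : ℝ) :
    HasDerivAt normalY (cos θ - (rho' θ * cos θ + rho θ * -sin θ)) θ :=
  (hasDerivAt_sin θ).sub ((hasDerivAt_rho θ).mul (hasDerivAt_cos θ))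

lemma continuous_curveX : Continuous curveX :=
  continuous_iff_continuousAt.2 fun θ => (hasDerivAt_curveX θ).continuousAt

lemma continuous_curveY : Continuous curveY :=
  continuous_iff_continuousAt.2 fun θ => (hasDerivAt_curveY θ).continuousAt

lemma continuous_normalX : Continuous normalX :=
  continuous_iff_continuousAt.2 fun θ => (hasDerivAt_normalX θ).continuousAt

lemma continuous_normalY : Continuous normalY :=
  continuous_iff_continuousAt.2 fun θ => (hasDerivAt_normalY θ).continuousAt

lemma normal_sq (θ : ℝ) : normalX θ ^ 2 + normalY θ ^ 2 = 1 + rho θ ^ 2 := by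
  simp only [normalX, normalY]
  linear_combination (1 + rho θ ^ 2) * sin_sq_add_cos_sq θ

lemma curveX_add_pi (θ : ℝ) : curveX (θ + π) = midX θ - cos θ := by
  rw [curveX, midX_add_pi, cos_add_pi]; ring

lemma curveY_add_pi (θ : ℝ) : curveY (θ + π) = midY θ - sin θ := by
  rw [curveY, midY_add_pi, sin_add_pi]; ring

lemma curveX_periodic : Function.Periodic curveX (2 * π) := fun θ => by
  rw [show θ + 2 * π = θ + π + π by ring, curveX_add_pi, midX_add_pi, cos_add_pi, curveX]; ring

lemma curveY_periodic : Function.Periodic curveY (2 * π) := fun θ => by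
  rw [show θ + 2 * π = θ + π + π by ring, curveY_add_pi, midY_add_pi, sin_add_pi, curveY]; ring

lemma normalX_add_pi (θ : ℝ) : normalX (θ + π) = -cos θ + rho θ * sin θ := by
  rw [normalX, rho_add_pi, cos_add_pi, sin_add_pi]; ring

lemma normalY_add_pi (θ : ℝ) : normalY (θ + π) = -sin θ - rho θ * cos θ := by
  rw [normalY, rho_add_pi, cos_add_pi, sin_add_pi]; ring

lemma normalX_periodic : Function.Periodic normalX (2 * π) := fun θ => by
  rw [show θ + 2 * π = θ + π + π by ring, normalX_add_pi, rho_add_pi, cos_add_pi, sin_add_pi,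
    normalX]
  ring

lemma normalY_periodic : Function.Periodic normalY (2 * π) := fun θ => by
  rw [show θ + 2 * π = θ + π + π by ring, normalY_add_pi, rho_add_pi, cos_add_pi, sin_add_pi,
    normalY]
  ring

/-- Up to a positive factor, the signed distance from the tangent line at `θ`, positive
outside the curve. -/
noncomputable def tangentGap (a b θ : ℝ) : ℝ :=
  (a - curveX θ) * normalX θ + (b - curveY θ) * normalY θ

lemma tangentGap_periodic (a b : ℝ) : Function.Periodic (tangentGap a b) (2 * π) := fun θ => by
  rw [tangentGap, curveX_periodic, curveY_periodic, normalX_periodic, normalY_periodic,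
    tangentGap]

/-- The direction angle of the outer normal. -/
noncomputable def normalAngle (θ : ℝ) : ℝ := θ - arctan (rho θ)

lemma strictMono_normalAngle : StrictMono normalAngle := by
  have h : ∀ θ, HasDerivAt normalAngle (1 - 1 / (1 + rho θ ^ 2) * rho' θ) θ := fun θ =>
    (hasDerivAt_id θ).sub (hasDerivAt_rho θ).arctan
  refine strictMono_of_deriv_pos fun θ => ?_
  rw [(h θ).deriv, one_div, inv_mul_eq_div, sub_pos, div_lt_one (by positivity)]
  nlinarith [rho'_lt_one θ, sq_nonneg (rho θ)]

lemma continuous_normalAngle : Continuous normalAngle := by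
  have : Continuous rho := continuous_iff_continuousAt.2 fun θ => (hasDerivAt_rho θ).continuousAt
  exact continuous_id.sub (continuous_arctan.comp this)

lemma normalAngle_add_two_pi (θ : ℝ) : normalAngle (θ + 2 * π) = normalAngle θ + 2 * π := by
  rw [normalAngle, show θ + 2 * π = θ + π + π by ring, rho_add_pi, rho_add_pi, normalAngle]
  ring_nf

lemma normal_eq (θ : ℝ) : normalX θ = √(1 + rho θ ^ 2) * cos (normalAngle θ) ∧
    normalY θ = √(1 + rho θ ^ 2) * sin (normalAngle θ) := by
  have h : √(1 + rho θ ^ 2) ≠ 0 := by positivity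
  rw [normalAngle, cos_sub, sin_sub, cos_arctan, sin_arctan, normalX, normalY]
  constructor <;> field_simp

lemma tangent_normal (τ θ : ℝ) : -normalY τ * normalX θ + normalX τ * normalY θ =
    -(√(1 + rho τ ^ 2) * √(1 + rho θ ^ 2) * sin (normalAngle τ - normalAngle θ)) := by
  rw [(normal_eq τ).1, (normal_eq τ).2, (normal_eq θ).1, (normal_eq θ).2, sin_sub]
  ring

/-- The curve lies strictly on the inner side of each of its tangent lines. -/
lemma tangentGap_curve_neg {τ θ : ℝ} (h1 : θ < τ) (h2 : τ < θ + 2 * π) :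
    tangentGap (curveX τ) (curveY τ) θ < 0 := by
  set f : ℝ → ℝ := fun τ => tangentGap (curveX τ) (curveY τ) θ with hf
  have hd : ∀ τ, HasDerivAt f (-normalY τ * normalX θ + normalX τ * normalY θ) τ := fun τ =>
    (((hasDerivAt_curveX τ).sub_const _).mul_const _).add
      (((hasDerivAt_curveY τ).sub_const _).mul_const _)
  have hc : Continuous f := continuous_iff_continuousAt.2 fun τ => (hd τ).continuousAt
  have hf0 : f θ = 0 := by simp [hf, tangentGap]
  have hf1 : f (θ + 2 * π) = 0 := by
    simp only [hf, curveX_periodic θ, curveY_periodic θ]; exact hf0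
  obtain ⟨σ, ⟨hσ1, hσ2⟩, hσ⟩ : normalAngle θ + π ∈ normalAngle '' Icc θ (θ + 2 * π) :=
    intermediate_value_Icc (by linarith) continuous_normalAngle.continuousOn
      ⟨by linarith [pi_pos], by rw [normalAngle_add_two_pi]; linarith [pi_pos]⟩
  rcases le_total τ σ with hτ | hτ
  · have : StrictAntiOn f (Icc θ σ) := by
      refine strictAntiOn_of_deriv_neg (convex_Icc _ _) hc.continuousOn fun x hx => ?_
      rw [interior_Icc] at hx
      rw [(hd x).deriv, tangent_normal, neg_neg_iff_pos]
      have ha := strictMono_normalAngle hx.1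
      have hb := strictMono_normalAngle hx.2
      have := sin_pos_of_pos_of_lt_pi (sub_pos.2 ha) (by linarith)
      positivity
    have := this ⟨le_rfl, hσ1⟩ ⟨h1.le, hτ⟩ h1
    linarith
  · have : StrictMonoOn f (Icc σ (θ + 2 * π)) := by
      refine strictMonoOn_of_deriv_pos (convex_Icc _ _) hc.continuousOn fun x hx => ?_
      rw [interior_Icc] at hx
      rw [(hd x).deriv, tangent_normal]
      have ha := strictMono_normalAngle hx.1
      have hb := strictMono_normalAngle hx.2
      rw [normalAngle_add_two_pi] at hb
      have h0 := sin_pos_of_pos_of_lt_pi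
        (show 0 < normalAngle x - normalAngle θ - π by linarith) (by linarith)
      rw [sin_sub_pi] at h0
      rw [← mul_neg]
      positivity
    have := this ⟨hτ, h2.le⟩ ⟨hσ2, le_rfl⟩ h2
    linarith

lemma tangentGap_curve_nonpos (τ θ : ℝ) : tangentGap (curveX τ) (curveY τ) θ ≤ 0 := by
  obtain ⟨σ, hσ, h⟩ := (tangentGap_periodic (curveX τ) (curveY τ)).exists_mem_Ico
    two_pi_pos θ (τ - 2 * π)
  rw [h]
  rcases eq_or_lt_of_le hσ.1 with h' | h'
  · rw [← h', ← curveX_periodic.sub_eq τ, ← curveY_periodic.sub_eq τ]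
    simp [tangentGap]
  · exact (tangentGap_curve_neg (by linarith [hσ.2]) (by linarith)).le

lemma eq_curve_of_tangentGap_eq_zero {a b θ : ℝ} (h : ∀ τ, tangentGap a b τ ≤ 0)
    (h0 : tangentGap a b θ = 0) : a = curveX θ ∧ b = curveY θ := by
  have hd : HasDerivAt (tangentGap a b) _ θ :=
    (((hasDerivAt_curveX θ).const_sub a).mul (hasDerivAt_normalX θ)).add
      (((hasDerivAt_curveY θ).const_sub b).mul (hasDerivAt_normalY θ))
  have hmax : IsLocalMax (tangentGap a b) θ := Eventually.of_forall fun τ => by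
    rw [h0]; exact h τ
  have h1 := hmax.hasDerivAt_eq_zero hd
  have hdet : 0 < 1 - rho' θ + rho θ ^ 2 := by
    nlinarith [rho'_lt_one θ, sq_nonneg (rho θ)]
  have hsc := sin_sq_add_cos_sq θ
  simp only [tangentGap] at h0
  simp only [normalX, normalY] at h0 h1
  have hu : (a - curveX θ) * (1 - rho' θ + rho θ ^ 2) = 0 := by
    linear_combination (cos θ - (rho' θ * cos θ + rho θ * -sin θ)) * h0 -
      (sin θ - rho θ * cos θ) * h1 - (a - curveX θ) * (1 - rho' θ + rho θ ^ 2) * hsc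
  have hv : (b - curveY θ) * (1 - rho' θ + rho θ ^ 2) = 0 := by
    linear_combination -(-sin θ + (rho' θ * sin θ + rho θ * cos θ)) * h0 +
      (cos θ + rho θ * sin θ) * h1 - (b - curveY θ) * (1 - rho' θ + rho θ ^ 2) * hsc
  constructor
  · have := (mul_eq_zero.1 hu).resolve_right hdet.ne'; linarith
  · have := (mul_eq_zero.1 hv).resolve_right hdet.ne'; linarith

lemma tangentGap_zero_mem (θ : ℝ) : tangentGap 0 0 θ ∈ Ioo (-2) 0 := by
  have hr := abs_le.1 (abs_rho_le θ)
  have e : tangentGap 0 0 θ = -1 - (midX θ * normalX θ + midY θ * normalY θ) := by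
    simp only [tangentGap, curveX, curveY, normalX, normalY]
    linear_combination -sin_sq_add_cos_sq θ
  have hX : |midX θ| ≤ 3 / 40 := by
    rw [midX, abs_le]
    constructor <;> linarith [neg_one_le_sin (4 * θ), sin_le_one (4 * θ), neg_one_le_sin (2 * θ),
      sin_le_one (2 * θ)]
  have hY : |midY θ| ≤ 3 / 40 := by
    rw [midY, abs_le]
    constructor <;> linarith [neg_one_le_cos (4 * θ), cos_le_one (4 * θ), neg_one_le_cos (2 * θ),
      cos_le_one (2 * θ)]
  have hn := normal_sq θ
  have hr2 : rho θ ^ 2 ≤ 1 := by nlinarith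
  have hP : |normalX θ| ≤ 2 :=
    abs_le_of_sq_le_sq (by nlinarith [sq_nonneg (normalY θ)]) (by norm_num)
  have hQ : |normalY θ| ≤ 2 :=
    abs_le_of_sq_le_sq (by nlinarith [sq_nonneg (normalX θ)]) (by norm_num)
  have h1 : |midX θ * normalX θ| ≤ 3 / 40 * 2 := by rw [abs_mul]; gcongr
  have h2 : |midY θ * normalY θ| ≤ 3 / 40 * 2 := by rw [abs_mul]; gcongr
  rw [e]
  constructor <;> linarith [(abs_le.1 h1).1, (abs_le.1 h2).1, (abs_le.1 h1).2, (abs_le.1 h2).2]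

/-- The region bounded by the Zindler curve, as an intersection of half-planes. -/
def body : Set Plane := {p | ∀ θ, tangentGap (p 0) (p 1) θ ≤ 0}

lemma continuous_tangentGap :
    Continuous fun q : Plane × ℝ => tangentGap (q.1 0) (q.1 1) q.2 := by
  have h1 := continuous_curveX
  have h2 := continuous_curveY
  have h3 := continuous_normalX
  have h4 := continuous_normalY
  unfold tangentGap
  fun_prop

lemma convex_body : Convex ℝ body := by
  intro p hp q hq s t hs ht hst θ
  have e : tangentGap ((s • p + t • q) 0) ((s • p + t • q) 1) θ =
      s * tangentGap (p 0) (p 1) θ + t * tangentGap (q 0) (q 1) θ := by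
    simp only [tangentGap, PiLp.add_apply, PiLp.smul_apply, smul_eq_mul]
    linear_combination (curveX θ * normalX θ + curveY θ * normalY θ) * hst
  rw [e]
  nlinarith [hp θ, hq θ]

lemma isClosed_body : IsClosed body := by
  have : body = ⋂ θ, {p : Plane | tangentGap (p 0) (p 1) θ ≤ 0} := by
    ext p; simp [body]
  rw [this]
  exact isClosed_iInter fun θ => isClosed_le
    (continuous_tangentGap.comp (Continuous.prodMk_left θ)) continuous_const

lemma isCompact_body : IsCompact body := by
  refine Metric.isCompact_of_isClosed_isBounded isClosed_body
    ((Metric.isBounded_closedBall (x := (0 : Plane)) (r := 10)).subset fun p hp => ?_)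
  have key : ∀ θ, p 0 * normalX θ + p 1 * normalY θ ≤ 2 := fun θ => by
    have h1 := (tangentGap_zero_mem θ).1
    have h2 := hp θ
    simp only [tangentGap] at h1 h2
    linarith
  have r2 : rho (π / 2) = 0 := by
    rw [rho, show 3 * (π / 2) = π / 2 + π by ring, cos_add_pi, cos_pi_div_two]; simp
  have r6 : rho (π / 6) = 0 := by
    rw [rho, show 3 * (π / 6) = π / 2 by ring, cos_pi_div_two]; simp
  have a1 := key (π / 2)
  have a2 := key (π / 2 + π)
  have a3 := key (π / 6)
  have a4 := key (π / 6 + π)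
  rw [normalX_add_pi, normalY_add_pi] at a2 a4
  simp only [normalX, normalY, r2, r6, cos_pi_div_two, sin_pi_div_two, cos_pi_div_six,
    sin_pi_div_six] at a1 a2 a3 a4
  have h3 : 1 ≤ √3 := Real.one_le_sqrt.2 (by norm_num)
  have hb : |p 1| ≤ 2 := abs_le.2 ⟨by linarith, by linarith⟩
  have hb' := abs_le.1 hb
  have ha : |p 0| * √3 ≤ 6 := by
    nth_rewrite 1 [← abs_of_nonneg (Real.sqrt_nonneg 3)]
    rw [← abs_mul]
    exact abs_le.2 ⟨by linarith, by linarith⟩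
  have ha' : |p 0| ≤ 6 := by nlinarith [abs_nonneg (p 0)]
  rw [mem_closedBall_zero_iff, EuclideanSpace.norm_eq, Fin.sum_univ_two]
  refine Real.sqrt_le_iff.2 ⟨by norm_num, ?_⟩
  simp only [Real.norm_eq_abs]
  nlinarith [abs_nonneg (p 0), abs_nonneg (p 1)]

lemma mem_interior_body {p : Plane} (hp : ∀ θ, tangentGap (p 0) (p 1) θ < 0) :
    p ∈ interior body := by
  have h : ∀ᶠ q in 𝓝 p, ∀ θ ∈ Icc 0 (2 * π), tangentGap (q 0) (q 1) θ < 0 :=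
    isCompact_Icc.eventually_forall_of_forall_eventually fun θ _ =>
      continuous_tangentGap.continuousAt.eventually_lt continuousAt_const (hp θ)
  rw [mem_interior_iff_mem_nhds]
  filter_upwards [h] with q hq θ
  obtain ⟨σ, hσ, e⟩ := (tangentGap_periodic (q 0) (q 1)).exists_mem_Ico₀ two_pi_pos θ
  rw [e]
  exact (hq σ ⟨hσ.1, hσ.2.le⟩).le

lemma frontier_body : frontier body = range fun θ => (!₂[curveX θ, curveY θ] : Plane) := by
  rw [isClosed_body.frontier_eq]
  ext p
  constructor
  · rintro ⟨hp, hp'⟩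
    obtain ⟨θ, hθ⟩ : ∃ θ, 0 ≤ tangentGap (p 0) (p 1) θ := by
      by_contra! h
      exact hp' (mem_interior_body h)
    have h := eq_curve_of_tangentGap_eq_zero hp (le_antisymm (hp θ) hθ)
    refine ⟨θ, ?_⟩
    ext i
    fin_cases i
    · simpa using h.1.symm
    · simpa using h.2.symm
  · rintro ⟨θ, rfl⟩
    refine ⟨fun τ => by simpa using tangentGap_curve_nonpos θ τ, fun h => ?_⟩
    have hc : Continuous fun t : ℝ =>
        (!₂[curveX θ + t * normalX θ, curveY θ + t * normalY θ] : Plane) :=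
      continuous_iff_continuousAt.2 fun t => (hasDerivAt_plane
        (((hasDerivAt_id t).mul_const (normalX θ)).const_add (curveX θ))
        (((hasDerivAt_id t).mul_const (normalY θ)).const_add (curveY θ))).continuousAt
    have h0 : ∀ᶠ t in 𝓝[>] (0 : ℝ),
        (!₂[curveX θ + t * normalX θ, curveY θ + t * normalY θ] : Plane) ∈ body := by
      refine (hc.tendsto 0).mono_left nhdsWithin_le_nhds ?_
      simpa using mem_interior_iff_mem_nhds.1 h
    obtain ⟨t, ht, ht0 : 0 < t⟩ := (h0.and self_mem_nhdsWithin).exists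
    have h1 : tangentGap (curveX θ + t * normalX θ) (curveY θ + t * normalY θ) θ ≤ 0 := ht θ
    have h2 := normal_sq θ
    have h3 : tangentGap (curveX θ + t * normalX θ) (curveY θ + t * normalY θ) θ =
        t * (1 + rho θ ^ 2) := by
      rw [← h2, tangentGap]; ring
    have h4 : 0 < t * (1 + rho θ ^ 2) := by positivity
    linarith

lemma curve_injOn {τ θ : ℝ} (h1 : θ < τ) (h2 : τ < θ + 2 * π) :
    (!₂[curveX θ, curveY θ] : Plane) ≠ !₂[curveX τ, curveY τ] := by
  intro h
  have hx : curveX θ = curveX τ := by simpa using congrArg (fun p : Plane => p 0) h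
  have hy : curveY θ = curveY τ := by simpa using congrArg (fun p : Plane => p 1) h
  have := tangentGap_curve_neg h1 h2
  simp [tangentGap, hx, hy] at this

lemma curve_not_circle (x₀ : Plane) (r : ℝ) :
    ¬ ∀ θ, ‖(!₂[curveX θ, curveY θ] : Plane) - x₀‖ = r := by
  intro h
  have key : ∀ θ, (curveX θ - x₀ 0) ^ 2 + (curveY θ - x₀ 1) ^ 2 = r ^ 2 := fun θ => by
    rw [← h θ, EuclideanSpace.norm_sq_eq, Fin.sum_univ_two]
    simp
  have h1 := key 0
  have h2 := key (0 + π)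
  have h3 := key (π / 2)
  have h4 := key (π / 2 + π)
  rw [curveX_add_pi, curveY_add_pi] at h2 h4
  have e1 : sin (4 * (π / 2)) = 0 := by rw [show 4 * (π / 2) = 2 * π by ring, sin_two_pi]
  have e2 : cos (4 * (π / 2)) = 1 := by rw [show 4 * (π / 2) = 2 * π by ring, cos_two_pi]
  have e3 : sin (2 * (π / 2)) = 0 := by rw [show 2 * (π / 2) = π by ring, sin_pi]
  have e4 : cos (2 * (π / 2)) = -1 := by rw [show 2 * (π / 2) = π by ring, cos_pi]
  simp only [curveX, curveY, midX, midY, mul_zero, sin_zero, cos_zero, sin_pi_div_two,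
    cos_pi_div_two, e1, e2, e3, e4] at h1 h2 h3 h4
  have hx : x₀ 0 = 0 := by linarith
  have hy : x₀ 1 = -3 / 40 := by linarith
  rw [hx, hy] at h1 h3
  linarith

end Zindler

open Zindler in
/-- Auerbach, Zindler curves: there exists a non-circular compact
convex plane body that floats in the archimedean sense in equilibrium in every
orientation at density `δ = 1/2`. -/
theorem exists_noncircular_floating_half :
    ∃ (Ω : Set Plane) (c : ℝ → Plane) (L : ℝ),
      IsCompact Ω ∧ Convex ℝ Ω ∧ (interior Ω).Nonempty ∧
      IsArclengthParam Ω c L ∧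
      (¬ ∃ (x₀ : Plane) (r : ℝ), 0 < r ∧ ∀ s : ℝ, ‖c s - x₀‖ = r) ∧
      ∀ s : ℝ, cutArea c L (1 / 2) s = cutArea c L (1 / 2) 0 := by
  have hrho : Continuous rho :=
    continuous_iff_continuousAt.2 fun θ => (hasDerivAt_rho θ).continuousAt
  set w : ℝ → ℝ := fun θ => √(1 + rho θ ^ 2) with hw
  have hwc : Continuous w := by fun_prop
  have hw1 : ∀ θ, 1 ≤ w θ := fun θ => Real.one_le_sqrt.2 (by nlinarith [sq_nonneg (rho θ)])
  have hwp : Function.Periodic w π := fun θ => by simp [hw, rho_add_pi]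
  obtain ⟨Θ, h, hh, hmono, hsurj, hder, hadd⟩ := exists_arclength_reparam hwc hw1 pi_pos hwp
  have hΘ : Continuous Θ := continuous_iff_continuousAt.2 fun s => (hder s).continuousAt
  have hadd2 : ∀ s, Θ (s + 2 * h) = Θ s + 2 * π := fun s => by
    rw [show s + 2 * h = s + h + h by ring, hadd, hadd]; ring
  have hX : ∀ s, HasDerivAt (fun s => curveX (Θ s)) (-normalY (Θ s) * (w (Θ s))⁻¹) s :=
    fun s => (hasDerivAt_curveX (Θ s)).comp s (hder s)
  have hY : ∀ s, HasDerivAt (fun s => curveY (Θ s)) (normalX (Θ s) * (w (Θ s))⁻¹) s :=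
    fun s => (hasDerivAt_curveY (Θ s)).comp s (hder s)
  have hw0 : ∀ θ, w θ ≠ 0 := fun θ => by linarith [hw1 θ]
  have hnX := continuous_normalX
  have hnY := continuous_normalY
  have hX' : Continuous fun s => -normalY (Θ s) * (w (Θ s))⁻¹ :=
    (hnY.comp hΘ).neg.mul ((hwc.comp hΘ).inv₀ fun s => hw0 _)
  have hY' : Continuous fun s => normalX (Θ s) * (w (Θ s))⁻¹ :=
    (hnX.comp hΘ).mul ((hwc.comp hΘ).inv₀ fun s => hw0 _)
  have hd := fun s => hasDerivAt_plane (hX s) (hY s)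
  refine ⟨body, fun s => !₂[curveX (Θ s), curveY (Θ s)], 2 * h, isCompact_body, convex_body,
    ⟨0, mem_interior_body fun θ => (tangentGap_zero_mem θ).2⟩,
    ⟨by positivity, ?_, fun s => ?_, fun s => ?_, ?_, ?_⟩, ?_, ?_⟩
  · rw [contDiff_euclidean]
    intro i
    fin_cases i
    · refine contDiff_one_iff_deriv.2 ⟨fun s => (hX s).differentiableAt, ?_⟩
      exact hX'.congr fun s => (hX s).deriv.symm
    · refine contDiff_one_iff_deriv.2 ⟨fun s => (hY s).differentiableAt, ?_⟩
      exact hY'.congr fun s => (hY s).deriv.symm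
  · have h1 : w (Θ s) ^ 2 = 1 + rho (Θ s) ^ 2 := Real.sq_sqrt (by positivity)
    rw [(hd s).deriv, EuclideanSpace.norm_eq, Fin.sum_univ_two, Real.sqrt_eq_one]
    simp only [Real.norm_eq_abs, sq_abs, Matrix.cons_val_zero,
      Matrix.cons_val_one]
    have := hw0 (Θ s)
    field_simp
    rw [h1, ← normal_sq]
    ring
  · simp only [hadd2, curveX_periodic (Θ s), curveY_periodic (Θ s)]
  · intro s hs t ht hst
    by_contra hne
    wlog hlt : s < t generalizing s t
    · exact this ht hs hst.symm (Ne.symm hne) (lt_of_le_of_ne (not_lt.1 hlt) (Ne.symm hne))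
    refine curve_injOn (hmono hlt) ?_ hst
    rw [← hadd2]
    exact hmono (by linarith [hs.1, ht.2])
  · rw [frontier_body]
    exact hsurj.range_comp fun θ => (!₂[curveX θ, curveY θ] : Plane)
  · rintro ⟨x₀, r, -, H⟩
    refine curve_not_circle x₀ r fun θ => ?_
    obtain ⟨s, rfl⟩ := hsurj θ
    exact H s
  · intro s
    refine cutArea_const hX hY hX' hY' (fun s => ?_) s 0
    rw [show 1 / 2 * (2 * h) = h by ring]
    simp only [hadd, hwp (Θ s), curveX_add_pi, curveY_add_pi, normalX_add_pi, normalY_add_pi]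
    simp only [curveX, curveY, normalX, normalY]
    ring
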